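/- For every integer a ≥ 3, every type-1 configuration of [a,3,1] admits a proper 7-coloring. -/

import Mathlib

/-- A cuboid with integer root and integer dimensions. -/
structure Cuboid where
  root : ℤ × ℤ × ℤ
  dims : ℤ × ℤ × ℤ
deriving DecidableEq

namespace Cuboid

/-- The dimensions are positive. -/
def valid (C : Cuboid) : Prop :=
  0 < C.dims.1 ∧ 0 < C.dims.2.1 ∧ 0 < C.dims.2.2

/-- The closed cuboid `[x,x+a] × [y,y+b] × [z,z+c] ⊆ ℝ³`. -/
def toSet (C : Cuboid) : Set (ℝ × ℝ × ℝ) :=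
  {p | (C.root.1 : ℝ) ≤ p.1 ∧ p.1 ≤ C.root.1 + C.dims.1 ∧
       (C.root.2.1 : ℝ) ≤ p.2.1 ∧ p.2.1 ≤ C.root.2.1 + C.dims.2.1 ∧
       (C.root.2.2 : ℝ) ≤ p.2.2 ∧ p.2.2 ≤ C.root.2.2 + C.dims.2.2}

/-- The open cuboid `(x,x+a) × (y,y+b) × (z,z+c) ⊆ ℝ³` (the interior). -/
def inte (C : Cuboid) : Set (ℝ × ℝ × ℝ) :=
  {p | (C.root.1 : ℝ) < p.1 ∧ p.1 < C.root.1 + C.dims.1 ∧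
       (C.root.2.1 : ℝ) < p.2.1 ∧ p.2.1 < C.root.2.1 + C.dims.2.1 ∧
       (C.root.2.2 : ℝ) < p.2.2 ∧ p.2.2 < C.root.2.2 + C.dims.2.2}

/-- The set `(ℤ×ℤ×ℝ) ∪ (ℤ×ℝ×ℤ) ∪ (ℝ×ℤ×ℤ)` of grid lines. -/
def grid : Set (ℝ × ℝ × ℝ) :=
  {p | ((∃ m : ℤ, p.1 = m) ∧ (∃ n : ℤ, p.2.1 = n)) ∨
       ((∃ m : ℤ, p.1 = m) ∧ (∃ n : ℤ, p.2.2 = n)) ∨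
       ((∃ m : ℤ, p.2.1 = m) ∧ (∃ n : ℤ, p.2.2 = n))}

/-- Two cuboids collide when their interiors intersect. -/
def Collide (C D : Cuboid) : Prop := (C.inte ∩ D.inte).Nonempty

/-- Two cuboids touch when their interiors are disjoint but their intersection
contains a point outside the grid lines (i.e. it is a non-degenerate rectangle). -/
def Touch (C D : Cuboid) : Prop :=
  ¬ Collide C D ∧ ∃ p ∈ C.toSet ∩ D.toSet, p ∉ grid

end Cuboid

/-- A configuration: a finite family of valid pairwise non-colliding cuboids. -/
def IsConfig (F : Finset Cuboid) : Prop :=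
  (∀ C ∈ F, C.valid) ∧ ∀ C ∈ F, ∀ D ∈ F, C ≠ D → ¬ Cuboid.Collide C D

/-- A type-1 configuration of `[a,b,c]`: every cuboid has dimensions exactly `(a,b,c)`. -/
def Type1 (a b c : ℕ) (F : Finset Cuboid) : Prop :=
  ∀ C ∈ F, C.dims = ((a : ℤ), (b : ℤ), (c : ℤ))

/-- A type-2 configuration of `[a,b,c]`: every cuboid has dimensions `(a,b,c)` or `(b,a,c)`. -/
def Type2 (a b c : ℕ) (F : Finset Cuboid) : Prop :=
  ∀ C ∈ F, C.dims = ((a : ℤ), (b : ℤ), (c : ℤ)) ∨ C.dims = ((b : ℤ), (a : ℤ), (c : ℤ))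

/-- A type-3 configuration of `[a,b,c]`: every cuboid's dimensions are a permutation of `(a,b,c)`. -/
def Type3 (a b c : ℕ) (F : Finset Cuboid) : Prop :=
  ∀ C ∈ F, C.dims = ((a : ℤ), (b : ℤ), (c : ℤ)) ∨ C.dims = ((a : ℤ), (c : ℤ), (b : ℤ)) ∨
    C.dims = ((b : ℤ), (a : ℤ), (c : ℤ)) ∨ C.dims = ((b : ℤ), (c : ℤ), (a : ℤ)) ∨
    C.dims = ((c : ℤ), (a : ℤ), (b : ℤ)) ∨ C.dims = ((c : ℤ), (b : ℤ), (a : ℤ))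

/-- A proper `k`-coloring of a configuration: touching cuboids get distinct colors. -/
def ProperColoring (k : ℕ) (F : Finset Cuboid) : Prop :=
  ∃ κ : Cuboid → Fin k, ∀ C ∈ F, ∀ D ∈ F, Cuboid.Touch C D → κ C ≠ κ D

namespace Cuboid

/-- Two cuboids of equal dimensions whose roots differ by less than the dimensions collide. -/
theorem collide_of_abs_root_sub_lt {C D : Cuboid} (h : C.dims = D.dims)
    (h₁ : |C.root.1 - D.root.1| < C.dims.1) (h₂ : |C.root.2.1 - D.root.2.1| < C.dims.2.1)
    (h₃ : |C.root.2.2 - D.root.2.2| < C.dims.2.2) : Collide C D := by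
  have midpoint_mem {u v d : ℤ} (huv : |u - v| < d) :
      ((u : ℝ) < ((u : ℝ) + v + d) / 2 ∧ ((u : ℝ) + v + d) / 2 < u + d) ∧
      ((v : ℝ) < ((u : ℝ) + v + d) / 2 ∧ ((u : ℝ) + v + d) / 2 < v + d) := by
    have huv' : |(u : ℝ) - v| < d := by exact_mod_cast huv
    obtain ⟨_, _⟩ := abs_lt.mp huv'
    refine ⟨⟨?_, ?_⟩, ?_, ?_⟩ <;> linarith
  obtain ⟨⟨a₁, a₂⟩, a₃, a₄⟩ := midpoint_mem h₁
  obtain ⟨⟨b₁, b₂⟩, b₃, b₄⟩ := midpoint_mem h₂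
  obtain ⟨⟨c₁, c₂⟩, c₃, c₄⟩ := midpoint_mem h₃
  refine ⟨(((C.root.1 : ℝ) + D.root.1 + C.dims.1) / 2,
    ((C.root.2.1 : ℝ) + D.root.2.1 + C.dims.2.1) / 2,
    ((C.root.2.2 : ℝ) + D.root.2.2 + C.dims.2.2) / 2), ⟨a₁, a₂, b₁, b₂, c₁, c₂⟩, ?_⟩
  rw [inte, ← h]
  exact ⟨a₃, a₄, b₃, b₄, c₃, c₄⟩

/-- If two intervals of integer length `d` with integer endpoints share a point `t`, then either
they overlap, or they are adjacent and `t` is an integer. -/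
theorem abs_sub_lt_or_eq_of_mem {u v d : ℤ} {t : ℝ} (hu : (u : ℝ) ≤ t) (hu' : t ≤ u + d)
    (hv : (v : ℝ) ≤ t) (hv' : t ≤ v + d) :
    |u - v| < d ∨ |u - v| = d ∧ ∃ m : ℤ, t = m := by
  have h₁ : u ≤ v + d := by exact_mod_cast hu.trans hv'
  have h₂ : v ≤ u + d := by exact_mod_cast hv.trans hu'
  rcases (abs_le.mpr ⟨by linarith, by linarith⟩ : |u - v| ≤ d).lt_or_eq with h | h
  · exact .inl h
  refine .inr ⟨h, ?_⟩
  rcases abs_cases (u - v) with ⟨h', _⟩ | ⟨h', _⟩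
  · refine ⟨u, le_antisymm (hv'.trans ?_) hu⟩
    exact_mod_cast (by linarith : v + d ≤ u)
  · refine ⟨v, le_antisymm (hu'.trans ?_) hv⟩
    exact_mod_cast (by linarith : u + d ≤ v)

/-- Touching cuboids of equal dimensions are adjacent in one direction and overlap in the other
two. -/
theorem Touch.root_cases {C D : Cuboid} (hT : Touch C D) (h : C.dims = D.dims) :
    (|C.root.1 - D.root.1| = C.dims.1 ∧ |C.root.2.1 - D.root.2.1| < C.dims.2.1 ∧
      |C.root.2.2 - D.root.2.2| < C.dims.2.2) ∨
    (|C.root.1 - D.root.1| < C.dims.1 ∧ |C.root.2.1 - D.root.2.1| = C.dims.2.1 ∧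
      |C.root.2.2 - D.root.2.2| < C.dims.2.2) ∨
    (|C.root.1 - D.root.1| < C.dims.1 ∧ |C.root.2.1 - D.root.2.1| < C.dims.2.1 ∧
      |C.root.2.2 - D.root.2.2| = C.dims.2.2) := by
  obtain ⟨hC, p, ⟨⟨a₁, a₂, b₁, b₂, c₁, c₂⟩, hD⟩, hp⟩ := hT
  rw [toSet, ← h] at hD
  obtain ⟨a₃, a₄, b₃, b₄, c₃, c₄⟩ := hD
  rcases abs_sub_lt_or_eq_of_mem a₁ a₂ a₃ a₄ with hx | ⟨hx, hx'⟩ <;>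
  rcases abs_sub_lt_or_eq_of_mem b₁ b₂ b₃ b₄ with hy | ⟨hy, hy'⟩ <;>
  rcases abs_sub_lt_or_eq_of_mem c₁ c₂ c₃ c₄ with hz | ⟨hz, hz'⟩
  · exact absurd (collide_of_abs_root_sub_lt h hx hy hz) hC
  · exact .inr (.inr ⟨hx, hy, hz⟩)
  · exact .inr (.inl ⟨hx, hy, hz⟩)
  · exact absurd (.inr (.inr ⟨hy', hz'⟩)) hp
  · exact .inl ⟨hx, hy, hz⟩
  · exact absurd (.inr (.inl ⟨hx', hz'⟩)) hp
  · exact absurd (.inl ⟨hx', hy'⟩) hp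
  · exact absurd (.inl ⟨hx', hy'⟩) hp

end Cuboid

theorem Int.abs_ediv_sub_ediv_le_one {a x y : ℤ} (ha : 0 < a) (h : |x - y| < a) :
    |x / a - y / a| ≤ 1 := by
  obtain ⟨_, _⟩ := abs_lt.mp h
  have h₁ : x / a ≤ (y + a) / a := Int.ediv_le_ediv ha (by linarith)
  have h₂ : y / a ≤ (x + a) / a := Int.ediv_le_ediv ha (by linarith)
  rw [Int.add_ediv_of_dvd_right (dvd_refl a), Int.ediv_self ha.ne'] at h₁ h₂
  exact abs_le.mpr ⟨by linarith, by linarith⟩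

theorem Int.abs_ediv_sub_ediv_eq_one {a x y : ℤ} (ha : 0 < a) (h : |x - y| = a) :
    |x / a - y / a| = 1 := by
  rcases abs_cases (x - y) with ⟨h', _⟩ | ⟨h', _⟩
  · rw [show x = y + a by linarith, Int.add_ediv_of_dvd_right (dvd_refl a), Int.ediv_self ha.ne']
    simp
  · rw [show y = x + a by linarith, Int.add_ediv_of_dvd_right (dvd_refl a), Int.ediv_self ha.ne']
    simp

/-- The seven arcs of the circle `ℤ / 20`, evaluated at `y + 5 * z + 10 * k`. -/
def arcColor (k y z : ℤ) : ℤ := 7 * ((y + 5 * z + 10 * k) % 20) / 20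

theorem arcColor_ne {k k' y y' z z' : ℤ}
    (h : (|k - k'| = 1 ∧ |y - y'| < 3 ∧ |z - z'| < 1) ∨
      (|k - k'| ≤ 1 ∧ |y - y'| = 3 ∧ |z - z'| < 1) ∨
      (|k - k'| ≤ 1 ∧ |y - y'| < 3 ∧ |z - z'| = 1)) :
    arcColor k y z ≠ arcColor k' y' z' := by
  unfold arcColor
  simp only [abs_lt, abs_le, abs_eq zero_le_one, abs_eq (zero_le_three (α := ℤ))] at h
  omega

/-- For `a ≥ 3`, every type-1 configuration of `[a,3,1]` admits a proper 7-coloring. -/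
theorem type1_a31_7colorable (a : ℕ) (ha : 3 ≤ a) :
    ∀ F : Finset Cuboid, IsConfig F → Type1 a 3 1 F → ProperColoring 7 F := by
  intro F _ hF
  have ha' : (0 : ℤ) < a := by omega
  let κ : Cuboid → ℤ := fun C => arcColor (C.root.1 / a) C.root.2.1 C.root.2.2
  have hκ (C : Cuboid) : 0 ≤ κ C ∧ κ C < 7 := by
    simp only [κ, arcColor]
    omega
  refine ⟨fun C => ⟨(κ C).toNat, by have := hκ C; omega⟩, fun C hC D hD hT heq => ?_⟩
  have hval : κ C = κ D := by
    have := hκ C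
    have := hκ D
    have := congrArg Fin.val heq
    simp only at this
    omega
  refine arcColor_ne ?_ hval
  have hcases := hT.root_cases ((hF C hC).trans (hF D hD).symm)
  simp only [hF C hC, Nat.cast_ofNat, Nat.cast_one] at hcases
  exact hcases.imp (And.imp_left (Int.abs_ediv_sub_ediv_eq_one ha'))
    (Or.imp (And.imp_left (Int.abs_ediv_sub_ediv_le_one ha'))
      (And.imp_left (Int.abs_ediv_sub_ediv_le_one ha')))
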